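/- If a surface S in projective 3-space contains a two-dimensional algebraic family of lines (i.e., through a general point of S there passes a one-dimensional family of lines contained in S), then S is a plane. -/

import Mathlib

open MvPolynomial

noncomputable def lineRestrict (a b : Fin 4 → ℂ) (p : MvPolynomial (Fin 4) ℂ) : Polynomial ℂ :=
  aeval (fun i => Polynomial.C (a i) + Polynomial.C (b i) * Polynomial.X) p

lemma lineRestrict_eval (a b : Fin 4 → ℂ) (p : MvPolynomial (Fin 4) ℂ) (t : ℂ) :
    (lineRestrict a b p).eval t = eval (a + t • b) p := by
  unfold lineRestrict
  induction p using MvPolynomial.induction_on with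
  | C r => simp
  | add p q hp hq => simp [hp, hq]
  | mul_X p i hp =>
    simp only [map_mul, aeval_X, Polynomial.eval_mul, hp, eval_X]
    simp
    left
    ring

lemma lineRestrict_deriv (a b : Fin 4 → ℂ) (p : MvPolynomial (Fin 4) ℂ) :
    (Polynomial.derivative (lineRestrict a b p)).eval 0
      = ∑ i, eval a (pderiv i p) * b i := by
  induction p using MvPolynomial.induction_on with
  | C r => simp [lineRestrict]
  | add p q hp hq =>
    have : lineRestrict a b (p + q) = lineRestrict a b p + lineRestrict a b q := by
      simp [lineRestrict]
    rw [this]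
    simp [hp, hq, add_mul, Finset.sum_add_distrib]
  | mul_X p i hp =>
    have : lineRestrict a b (p * X i) = lineRestrict a b p *
        (Polynomial.C (a i) + Polynomial.C (b i) * Polynomial.X) := by
      simp [lineRestrict]
    have h0 := lineRestrict_eval a b p 0
    rw [this]
    simp only [Polynomial.derivative_mul, Polynomial.eval_add, Polynomial.eval_mul, hp, h0]
    simp only [pderiv_mul, pderiv_X, map_add, map_mul, eval_X, add_mul, Finset.sum_add_distrib]
    simp [Finset.sum_mul, Pi.single_apply, apply_ite]
    refine Finset.sum_congr rfl fun j _ => by ring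

lemma finrank_lt_sup_span {K : Submodule ℂ (Fin 4 → ℂ)} {s : Set (Fin 4 → ℂ)} {u : Fin 4 → ℂ}
    (hu : u ∉ Submodule.span ℂ s) (hs : s ⊆ K) (huK : u ∈ K) :
    Submodule.span ℂ (insert u s) ≤ K ∧
    Module.finrank ℂ (Submodule.span ℂ s) + 1 ≤
      Module.finrank ℂ (Submodule.span ℂ (insert u s)) := by
  constructor
  · exact Submodule.span_le.2 (Set.insert_subset huK hs)
  · apply Nat.succ_le_of_lt
    apply Submodule.finrank_lt_finrank_of_lt
    refine lt_of_le_of_ne (Submodule.span_mono (Set.subset_insert _ _)) ?_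
    intro h
    exact hu (h ▸ Submodule.subset_span (Set.mem_insert _ _))

lemma plane_eq_span {L : Submodule ℂ (Fin 4 → ℂ)} {x u : Fin 4 → ℂ}
    (hL : Module.finrank ℂ L = 2) (hx0 : x ≠ 0) (hx : x ∈ L) (hu : u ∈ L)
    (hxu : u ∉ Submodule.span ℂ {x}) : L = Submodule.span ℂ {u, x} := by
  obtain ⟨h1, h2⟩ := finrank_lt_sup_span hxu (Set.singleton_subset_iff.2 hx) hu
  rw [finrank_span_singleton hx0] at h2
  exact (Submodule.eq_of_le_of_finrank_le h1 (by omega)).symm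

lemma vanish_on_hyperplane (p : MvPolynomial (Fin 4) ℂ) (x : Fin 4 → ℂ) (hx0 : x ≠ 0)
    (H : Submodule ℂ (Fin 4 → ℂ)) (hH : Module.finrank ℂ H = 3)
    (hinf : {L : Submodule ℂ (Fin 4 → ℂ) |
        Module.finrank ℂ L = 2 ∧ x ∈ L ∧ L ≤ H ∧ ∀ v ∈ L, eval v p = 0}.Infinite)
    (y : Fin 4 → ℂ) (hy : y ∈ H) : eval y p = 0 := by
  obtain ⟨L₀, -, hxL₀, hL₀H, hL₀⟩ := hinf.nonempty
  by_cases hyx : y ∈ Submodule.span ℂ {x}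
  · exact hL₀ y ((Submodule.span_singleton_le_iff_mem _ _).2 hxL₀ hyx)
  have hxH := hL₀H hxL₀
  obtain ⟨h1, h2⟩ := finrank_lt_sup_span hyx (Set.singleton_subset_iff.2 hxH) hy
  rw [finrank_span_singleton hx0] at h2
  have h3 : Module.finrank ℂ (Submodule.span ℂ ({y, x} : Set (Fin 4 → ℂ))) ≤ 2 := by
    classical
    have := finrank_span_finset_le_card (R := ℂ) ({y, x} : Finset (Fin 4 → ℂ))
    have h4 := Finset.card_le_two (a := y) (b := x)
    simp only [Finset.coe_insert, Finset.coe_singleton] at this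
    exact this.trans h4
  obtain ⟨z, hzH, hz⟩ : ∃ z ∈ H, z ∉ Submodule.span ℂ ({y, x} : Set (Fin 4 → ℂ)) := by
    by_contra hcon
    push Not at hcon
    have : H ≤ Submodule.span ℂ ({y, x} : Set (Fin 4 → ℂ)) := hcon
    have := Submodule.finrank_mono this
    omega
  have hyxH : ({y, x} : Set (Fin 4 → ℂ)) ⊆ H :=
    Set.insert_subset hy (Set.singleton_subset_iff.2 hxH)
  obtain ⟨h5, h6⟩ := finrank_lt_sup_span hz hyxH hzH
  have hspan : Submodule.span ℂ (insert z ({y, x} : Set (Fin 4 → ℂ))) = H :=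
    Submodule.eq_of_le_of_finrank_le h5 (by omega)
  by_contra hpy
  have hne : lineRestrict y z p ≠ 0 := by
    intro h
    have := lineRestrict_eval y z p 0
    rw [h] at this
    simp at this
    exact hpy this.symm
  have hfin : {t | (lineRestrict y z p).IsRoot t}.Finite := by
    by_contra h
    exact hne (Polynomial.eq_zero_of_infinite_isRoot _ h)
  refine hinf (((hfin.image (fun t => Submodule.span ℂ {y + t • z, x})).union
    (Set.finite_singleton (Submodule.span ℂ {z, x}))).subset ?_)
  rintro L ⟨hL2, hxL, hLH, hLp⟩
  obtain ⟨w, hwL, hw⟩ : ∃ w ∈ L, w ∉ Submodule.span ℂ {x} := by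
    by_contra hcon
    push Not at hcon
    have : L ≤ Submodule.span ℂ {x} := hcon
    have := Submodule.finrank_mono this
    rw [finrank_span_singleton hx0] at this
    omega
  have hwH := hLH hwL
  rw [← hspan, Submodule.mem_span_insert] at hwH
  obtain ⟨c, w', hw', hwe⟩ := hwH
  rw [Submodule.mem_span_pair] at hw'
  obtain ⟨b, a, hba⟩ := hw'
  have key : ∀ r : ℂ, ∀ u, r ≠ 0 → w = r • u + a • x → L = Submodule.span ℂ {u, x} := by
    intro r u hr hwu
    have hu : u = r⁻¹ • (w - a • x) := by
      rw [hwu, add_sub_cancel_right, smul_smul, inv_mul_cancel₀ hr, one_smul]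
    apply plane_eq_span hL2 hx0 hxL
    · rw [hu]
      exact L.smul_mem _ (L.sub_mem hwL (L.smul_mem _ hxL))
    · intro hux
      apply hw
      rw [hwu]
      exact Submodule.add_mem _ (Submodule.smul_mem _ _ hux)
        (Submodule.smul_mem _ _ (Submodule.mem_span_singleton_self x))
  by_cases hb : b = 0
  · right
    have hc : c ≠ 0 := by
      rintro rfl
      apply hw
      rw [hwe, ← hba, hb]
      simpa using Submodule.smul_mem _ a (Submodule.mem_span_singleton_self x)
    apply key c z hc
    rw [hwe, ← hba, hb]
    simp
  · left
    have hLe := key b (y + (c / b) • z) hb (by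
      rw [hwe, ← hba, smul_add, smul_smul, mul_div_cancel₀ _ hb]
      abel)
    refine ⟨c / b, ?_, hLe.symm⟩
    change (lineRestrict y z p).eval (c / b) = 0
    rw [lineRestrict_eval]
    apply hLp
    rw [hLe]
    exact Submodule.subset_span (Set.mem_insert _ _)

lemma dvd_pow_of_vanish (f g : MvPolynomial (Fin 4) ℂ)
    (h : ∀ x, eval x f = 0 → eval x g = 0) : ∃ n, f ∣ g ^ n := by
  have hg : g ∈ vanishingIdeal ℂ (zeroLocus ℂ (Ideal.span {f})) := by
    rw [mem_vanishingIdeal_iff]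
    intro x hx
    rw [mem_zeroLocus_iff] at hx
    have := hx f (Ideal.mem_span_singleton_self f)
    rw [aeval_eq_eval] at this ⊢
    exact h x this
  rw [vanishingIdeal_zeroLocus_eq_radical] at hg
  obtain ⟨n, hn⟩ := hg
  exact ⟨n, Ideal.mem_span_singleton.1 hn⟩

/-- If a surface S in projective 3-space contains a two-dimensional algebraic family
of lines (i.e., through a general point of S there passes a one-dimensional family of
lines contained in S), then S is a plane.

S is realized by its affine cone: the zero set in ℂ⁴ of an irreducible homogeneous
polynomial p of degree d ≥ 1. A line in P³ corresponds to a 2-dimensional linear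
subspace of ℂ⁴ contained in the cone. The hypothesis is expressed as: there is a
Zariski-dense subset T of S (every polynomial vanishing on T vanishes on S) such that
through every nonzero point of T there pass infinitely many lines contained in S.
The conclusion: S is the zero set of a linear form, i.e. a plane. -/
theorem stmt_0 (p : MvPolynomial (Fin 4) ℂ) (d : ℕ) (hd : 1 ≤ d)
    (hhom : p.IsHomogeneous d) (hirr : Irreducible p)
    (S : Set (Fin 4 → ℂ)) (hS : S = {x | eval x p = 0})
    (T : Set (Fin 4 → ℂ)) (hTS : T ⊆ S)
    (hTdense : ∀ g : MvPolynomial (Fin 4) ℂ,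
      (∀ x ∈ T, eval x g = 0) → ∀ x ∈ S, eval x g = 0)
    (hfamily : ∀ x ∈ T, x ≠ 0 →
      {L : Submodule ℂ (Fin 4 → ℂ) |
        Module.finrank ℂ L = 2 ∧ x ∈ L ∧ (L : Set (Fin 4 → ℂ)) ⊆ S}.Infinite) :
    ∃ ℓ : MvPolynomial (Fin 4) ℂ, ℓ.IsHomogeneous 1 ∧ ℓ ≠ 0 ∧
      S = {x | eval x ℓ = 0} := by
  have hprime : Prime p := hirr.prime
  have hp0 : p ≠ 0 := hirr.ne_zero
  -- a smooth point
  obtain ⟨x, hxT, i₀, hxi⟩ : ∃ x ∈ T, ∃ i, eval x (pderiv i p) ≠ 0 := by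
    by_contra hcon
    push Not at hcon
    have hz : ∀ i, pderiv i p = 0 := by
      intro i
      have h1 := hTdense (pderiv i p) (fun x hx => hcon x hx i)
      obtain ⟨n, hn⟩ := dvd_pow_of_vanish p (pderiv i p) (fun x hx => h1 x (by rw [hS]; exact hx))
      obtain ⟨r, hr⟩ := hprime.dvd_of_dvd_pow hn
      by_contra hne
      have hr0 : r ≠ 0 := by
        rintro rfl
        exact hne (by simpa using hr)
      have h2 := totalDegree_mul_of_isDomain hp0 hr0
      rw [← hr, hhom.totalDegree hp0] at h2
      have h3 := (hhom.pderiv (i := i)).totalDegree hne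
      omega
    have hE := hhom.sum_X_mul_pderiv
    simp only [hz, mul_zero, Finset.sum_const_zero] at hE
    rcases smul_eq_zero.1 hE.symm with h | h
    · omega
    · exact hp0 h
  by_cases hd1 : d = 1
  · subst hd1
    exact ⟨p, hhom, hp0, hS⟩
  have hx0 : x ≠ 0 := by
    rintro rfl
    apply hxi
    have h1 : (pderiv i₀ p).IsHomogeneous (d - 1) := hhom.pderiv
    have h2 : coeff 0 (pderiv i₀ p) = 0 := h1.coeff_eq_zero (by simp; omega)
    rw [← constantCoeff_eq] at h2
    simpa using h2
  let ℓ : MvPolynomial (Fin 4) ℂ := ∑ i, C (eval x (pderiv i p)) * X i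
  have hℓ : ∀ v, eval v ℓ = ∑ i, eval x (pderiv i p) * v i := by
    intro v
    simp [ℓ]
  have hℓhom : ℓ.IsHomogeneous 1 := by
    apply IsHomogeneous.sum
    intro i _
    simpa using (isHomogeneous_C (Fin 4) (eval x (pderiv i p))).mul (isHomogeneous_X ℂ i)
  have hℓi : eval (Pi.single i₀ 1) ℓ ≠ 0 := by
    rw [hℓ]
    simpa [Pi.single_apply] using hxi
  have hℓ0 : ℓ ≠ 0 := by
    intro h
    rw [h] at hℓi
    simp at hℓi
  let φ : (Fin 4 → ℂ) →ₗ[ℂ] ℂ := ∑ i, (eval x (pderiv i p)) • LinearMap.proj i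
  have hφ : ∀ v, φ v = eval v ℓ := by
    intro v
    rw [hℓ]
    simp [φ]
  have hφ0 : φ ≠ 0 := by
    intro h
    rw [← hφ, h] at hℓi
    simp at hℓi
  have hker : Module.finrank ℂ (LinearMap.ker φ) = 3 := by
    have h1 := LinearMap.finrank_range_add_finrank_ker φ
    have h2 : LinearMap.range φ = ⊤ := LinearMap.range_eq_top.2 (LinearMap.surjective hφ0)
    rw [h2, finrank_top] at h1
    simp at h1
    omega
  have hvan : ∀ y, eval y ℓ = 0 → eval y p = 0 := by
    intro y hy
    refine vanish_on_hyperplane p x hx0 (LinearMap.ker φ) hker ?_ y (by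
      rw [LinearMap.mem_ker, hφ, hy])
    refine (hfamily x hxT hx0).mono ?_
    rintro L ⟨hL2, hxL, hLS⟩
    have hLp : ∀ v ∈ L, eval v p = 0 := by
      intro v hv
      have := hLS hv
      rw [hS] at this
      exact this
    refine ⟨hL2, hxL, ?_, hLp⟩
    intro v hv
    rw [LinearMap.mem_ker, hφ, hℓ, ← lineRestrict_deriv]
    have : lineRestrict x v p = 0 := by
      apply Polynomial.funext
      intro t
      rw [lineRestrict_eval, Polynomial.eval_zero]
      exact hLp _ (L.add_mem hxL (L.smul_mem t hv))
    rw [this]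
    simp
  refine ⟨ℓ, hℓhom, hℓ0, ?_⟩
  obtain ⟨n, hn⟩ := dvd_pow_of_vanish ℓ p hvan
  obtain ⟨k, -, hk⟩ := (dvd_prime_pow hprime n).1 hn
  have hk0 : k ≠ 0 := by
    rintro rfl
    rw [pow_zero, associated_one_iff_isUnit] at hk
    have := hk.map (eval (0 : Fin 4 → ℂ))
    rw [hℓ] at this
    simp at this
  have hpl : p ∣ ℓ := (dvd_pow_self p hk0).trans hk.symm.dvd
  rw [hS]
  ext y
  refine ⟨fun hy => ?_, fun hy => hvan y hy⟩
  obtain ⟨q, hq⟩ := hpl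
  change eval y p = 0 at hy
  change eval y ℓ = 0
  rw [hq, map_mul, hy, zero_mul]
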